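/- The density d(2) satisfies γ < 1/√3 < d(2), where γ is the Euler–Mascheroni constant; in particular d(2) ≠ γ and d(2) ≠ 1/√3. -/

import Mathlib

open Filter Topology

/-- `TowerMem q n` means that the prime `q` occurs somewhere in the tower
factorization of the positive integer `n`:  `1 ∉ M(q)`, and for `n ≥ 2`,
`n ∈ M(q)` iff `q ∣ n` or some exponent in the prime factorization of `n`
lies in `M(q)`. -/
inductive TowerMem (q : ℕ) : ℕ → Prop
  | base (n : ℕ) (hn : 2 ≤ n) (hdvd : q ∣ n) : TowerMem q n
  | step (n p : ℕ) (hn : 2 ≤ n) (hp : p.Prime) (hdvd : p ∣ n)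
      (hexp : TowerMem q (n.factorization p)) : TowerMem q n

open Classical in
/-- The proportion of the integers `{1, …, N}` that lie in `M(q)`. -/
noncomputable def towerRatio (q N : ℕ) : ℝ :=
  (((Finset.Icc 1 N).filter fun n => TowerMem q n).card : ℝ) / (N : ℝ)

/-- The number of integers in `{1, …, N}` satisfying `A`. -/
noncomputable def countUpTo (A : ℕ → Prop) (N : ℕ) : ℕ :=
  open Classical in ((Finset.Icc 1 N).filter A).card

/-- The predicate `A` on positive integers has natural density `δ`. -/
def HasNatDensity (A : ℕ → Prop) (δ : ℝ) : Prop :=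
  Tendsto (fun N : ℕ => (countUpTo A N : ℝ) / N) atTop (𝓝 δ)

open Classical in
lemma countUpTo_eq_sum (A : ℕ → Prop) (N : ℕ) :
    (countUpTo A N : ℝ) = ∑ n ∈ Finset.Icc 1 N, if A n then (1 : ℝ) else 0 := by
  simp [countUpTo]

lemma countUpTo_and_dvd {A : ℕ → Prop} {k : ℕ} (hk : 0 < k)
    (hA : ∀ m, 1 ≤ m → (A (k * m) ↔ A m)) (N : ℕ) :
    countUpTo (fun n => A n ∧ k ∣ n) N = countUpTo A (N / k) := by
  classical
  unfold countUpTo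
  symm
  apply Finset.card_bij (fun m _ => k * m)
  · intro m hm
    simp only [Finset.mem_filter, Finset.mem_Icc] at hm ⊢
    obtain ⟨⟨h1, h2⟩, h3⟩ := hm
    refine ⟨⟨Nat.mul_pos hk h1, ?_⟩, (hA m h1).2 h3, dvd_mul_right _ _⟩
    rw [mul_comm]
    exact (Nat.le_div_iff_mul_le hk).1 h2
  · intro a _ b _ h
    exact Nat.eq_of_mul_eq_mul_left hk h
  · intro b hb
    simp only [Finset.mem_filter, Finset.mem_Icc] at hb
    obtain ⟨⟨h1, h2⟩, h3, m, rfl⟩ := hb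
    have hm : 1 ≤ m := Nat.pos_of_mul_pos_left h1
    refine ⟨m, ?_, rfl⟩
    simp only [Finset.mem_filter, Finset.mem_Icc]
    refine ⟨⟨hm, (Nat.le_div_iff_mul_le hk).2 ?_⟩, (hA m hm).1 h3⟩
    rwa [mul_comm]

lemma HasNatDensity.and_dvd {A : ℕ → Prop} {δ : ℝ} (h : HasNatDensity A δ) {k : ℕ} (hk : 0 < k)
    (hA : ∀ m, 1 ≤ m → (A (k * m) ↔ A m)) :
    HasNatDensity (fun n => A n ∧ k ∣ n) (δ * (k : ℝ)⁻¹) := by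
  unfold HasNatDensity
  simp only [countUpTo_and_dvd hk hA]
  have h1 : Tendsto (fun N : ℕ => N / k) atTop atTop := Nat.tendsto_div_const_atTop hk.ne'
  have h2 := h.comp h1
  have h3 : Tendsto (fun N : ℕ => ((N / k : ℕ) : ℝ) / N) atTop (𝓝 (k : ℝ)⁻¹) := by
    have := (tendsto_nat_floor_mul_div_atTop (R := ℝ) (a := (k : ℝ)⁻¹) (by positivity)).comp
      tendsto_natCast_atTop_atTop
    refine this.congr fun N => ?_
    simp only [Function.comp]
    rw [inv_mul_eq_div, Nat.floor_div_eq_div]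
  refine (h2.mul h3).congr' ?_
  filter_upwards [eventually_ge_atTop k] with N hN
  have : ((N / k : ℕ) : ℝ) ≠ 0 := by
    have := Nat.div_pos hN hk
    positivity
  simp only [Function.comp]
  field_simp

lemma HasNatDensity.and_factorization_notMem {A : ℕ → Prop} {δ : ℝ} (h : HasNatDensity A δ)
    {p : ℕ} (hp : p.Prime) (hA : ∀ m, 1 ≤ m → (A (p * m) ↔ A m)) (S : Finset ℕ) :
    HasNatDensity (fun n => A n ∧ n.factorization p ∉ S)
      (δ * (1 - ∑ e ∈ S, ((p : ℝ)⁻¹ ^ e - (p : ℝ)⁻¹ ^ (e + 1)))) := by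
  classical
  have hpow : ∀ e m, 1 ≤ m → (A (p ^ e * m) ↔ A m) := by
    intro e
    induction e with
    | zero => simp
    | succ e ih =>
      intro m hm
      rw [pow_succ', mul_assoc, hA _ (Nat.mul_pos (pow_pos hp.pos e) hm), ih m hm]
  have hd : ∀ e, HasNatDensity (fun n => A n ∧ p ^ e ∣ n) (δ * (p : ℝ)⁻¹ ^ e) := fun e => by
    simpa using h.and_dvd (pow_pos hp.pos e) (hpow e)
  have key : ∀ N, (countUpTo (fun n => A n ∧ n.factorization p ∉ S) N : ℝ) =
      countUpTo A N - ∑ e ∈ S, ((countUpTo (fun n => A n ∧ p ^ e ∣ n) N : ℝ) -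
        countUpTo (fun n => A n ∧ p ^ (e + 1) ∣ n) N) := by
    intro N
    simp only [countUpTo_eq_sum, ← Finset.sum_sub_distrib]
    rw [Finset.sum_comm, ← Finset.sum_sub_distrib]
    refine Finset.sum_congr rfl fun n hn => ?_
    have hn0 : n ≠ 0 := by
      have := (Finset.mem_Icc.1 hn).1
      omega
    by_cases hAn : A n
    · trans 1 - ∑ e ∈ S, if n.factorization p = e then (1 : ℝ) else 0
      · rw [Finset.sum_ite_eq]
        by_cases hS : n.factorization p ∈ S <;> simp [hAn, hS]
      · simp only [hAn, if_true]
        congr 1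
        refine Finset.sum_congr rfl fun e _ => ?_
        simp only [true_and, hp.pow_dvd_iff_le_factorization hn0]
        split_ifs <;> first | omega | norm_num
    · simp [hAn]
  unfold HasNatDensity at *
  have := h.sub (tendsto_finsetSum S fun e _ => (hd e).sub (hd (e + 1)))
  convert this using 1
  · funext N
    rw [key, sub_div, Finset.sum_div]
    simp only [sub_div]
  · rw [mul_sub, mul_one, Finset.mul_sum]
    simp only [mul_sub]

lemma hasNatDensity_true : HasNatDensity (fun _ => True) 1 := by
  refine tendsto_const_nhds.congr' ?_
  filter_upwards [eventually_gt_atTop 0] with N hN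
  have : (N : ℝ) ≠ 0 := by positivity
  simp [countUpTo, this]

lemma hasNatDensity_odd : HasNatDensity Odd (1 / 2) := by
  classical
  have h := hasNatDensity_true
  have h2 := h.sub (h.and_dvd two_pos (by simp))
  refine (h2.congr fun N => ?_).trans_eq ?_
  · rw [← sub_div, countUpTo_eq_sum, countUpTo_eq_sum, countUpTo_eq_sum, ← Finset.sum_sub_distrib]
    congr 1
    refine Finset.sum_congr rfl fun n _ => ?_
    rcases Nat.even_or_odd n with hn | hn
    · simp [hn.two_dvd, hn]
    · simp [hn, hn.not_two_dvd_nat]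
  · norm_num

/-- Odd numbers whose exponents at the primes in `T` avoid `S`. -/
def OddAvoiding (S T : Finset ℕ) (n : ℕ) : Prop :=
  Odd n ∧ ∀ p ∈ T, n.factorization p ∉ S

/-- The density of the integers whose exponent at `p` avoids `S`. -/
noncomputable def avoidFactor (S : Finset ℕ) (p : ℕ) : ℝ :=
  1 - ∑ e ∈ S, ((p : ℝ)⁻¹ ^ e - (p : ℝ)⁻¹ ^ (e + 1))

lemma hasNatDensity_oddAvoiding (S T : Finset ℕ) (hT : ∀ p ∈ T, p.Prime ∧ p ≠ 2) :
    HasNatDensity (OddAvoiding S T) (1 / 2 * ∏ p ∈ T, avoidFactor S p) := by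
  classical
  induction T using Finset.induction_on with
  | empty =>
    have : OddAvoiding S ∅ = Odd := by
      funext n
      simp [OddAvoiding]
    simpa [this] using hasNatDensity_odd
  | insert q T hq ih =>
    have hqp := hT q (Finset.mem_insert_self q T)
    have ih' := ih fun p hp => hT p (Finset.mem_insert_of_mem hp)
    have hinv : ∀ m, 1 ≤ m → (OddAvoiding S T (q * m) ↔ OddAvoiding S T m) := by
      intro m hm
      unfold OddAvoiding
      have hodd : Odd q := hqp.1.odd_of_ne_two hqp.2
      have : ∀ p ∈ T, (q * m).factorization p = m.factorization p := by
        intro p hp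
        have hne : q ≠ p := fun h => hq (h ▸ hp)
        rw [Nat.factorization_mul hqp.1.ne_zero (by omega), hqp.1.factorization]
        simp [hne]
      simp only [Nat.odd_mul, hodd, true_and]
      refine and_congr_right fun _ => forall₂_congr fun p hp => by rw [this p hp]
    have := ih'.and_factorization_notMem hqp.1 hinv S
    rw [Finset.prod_insert hq]
    convert this using 1
    · funext n
      simp only [OddAvoiding, Finset.forall_mem_insert, eq_iff_iff]
      tauto
    · rw [avoidFactor]
      ring

/-- Some exponents lying in `M(2)`. -/
def towerExponents : Finset ℕ := {2, 4, 6, 8, 9, 10, 12, 14}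

lemma towerMem_of_mem_towerExponents {e : ℕ} (he : e ∈ towerExponents) : TowerMem 2 e := by
  simp only [towerExponents, Finset.mem_insert, Finset.mem_singleton] at he
  have h9 : TowerMem 2 9 := by
    refine .step 9 3 (by norm_num) Nat.prime_three (by norm_num) ?_
    have : Nat.factorization 9 3 = 2 := by
      rw [show 9 = 3 ^ 2 by norm_num, Nat.prime_three.factorization_pow]
      simp
    rw [this]
    exact .base 2 le_rfl dvd_rfl
  rcases he with rfl | rfl | rfl | rfl | rfl | rfl | rfl | rfl
  all_goals first | exact h9 | exact .base _ (by norm_num) (by norm_num)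

lemma oddAvoiding_of_not_towerMem {T : Finset ℕ} (hT : ∀ p ∈ T, p.Prime) {n : ℕ} (hn : 1 ≤ n)
    (h : ¬ TowerMem 2 n) : OddAvoiding towerExponents T n := by
  constructor
  · by_contra hodd
    have hdvd := (Nat.not_odd_iff_even.1 hodd).two_dvd
    exact h (.base n (Nat.le_of_dvd hn hdvd) hdvd)
  · intro p hp he
    have hmem := towerMem_of_mem_towerExponents he
    have hpos : n.factorization p ≠ 0 := by
      intro h0
      rw [h0] at he
      exact absurd he (by decide)
    have hdvd := Nat.dvd_of_factorization_pos hpos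
    exact h (.step n p ((hT p hp).two_le.trans (Nat.le_of_dvd hn hdvd)) (hT p hp) hdvd hmem)

lemma one_sub_le_of_tendsto_towerRatio {d : ℝ} (hd : Tendsto (towerRatio 2) atTop (𝓝 d))
    {T : Finset ℕ} (hT : ∀ p ∈ T, p.Prime ∧ p ≠ 2) :
    1 - d ≤ 1 / 2 * ∏ p ∈ T, avoidFactor towerExponents p := by
  classical
  refine le_of_tendsto_of_tendsto (hasNatDensity_true.sub hd)
    (hasNatDensity_oddAvoiding towerExponents T hT) (Eventually.of_forall fun N => ?_)
  simp only [towerRatio, ← sub_div]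
  gcongr
  have : ((Finset.Icc 1 N).filter fun n => TowerMem 2 n).card = countUpTo (TowerMem 2) N := by
    unfold countUpTo
    congr!
  rw [this, countUpTo_eq_sum, countUpTo_eq_sum, countUpTo_eq_sum, ← Finset.sum_sub_distrib]
  refine Finset.sum_le_sum fun n hn => ?_
  by_cases h : TowerMem 2 n
  · simp only [h, if_true, sub_self]
    split_ifs <;> norm_num
  · simp [h, oddAvoiding_of_not_towerMem (fun p hp => (hT p hp).1) (Finset.mem_Icc.1 hn).1 h]

/-- The factor at `p` of the density, relative to the Euler factor of `ζ(2)⁻¹`. -/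
noncomputable def relFactor (p : ℕ) : ℝ :=
  avoidFactor towerExponents p / (1 - ((p : ℝ) ^ 2)⁻¹)

/-- The numerator of `relFactor n`. -/
def relNum (n : ℕ) : ℕ :=
  n ^ 15 - (n - 1) * (n ^ 12 + n ^ 10 + n ^ 8 + n ^ 6 + n ^ 5 + n ^ 4 + n ^ 2 + 1)

/-- The denominator of `relFactor n`. -/
def relDen (n : ℕ) : ℕ := n ^ 13 * (n ^ 2 - 1)

/-- For `n < 2000`, this holds exactly when `n` is an odd prime. -/
def SmallOddPrime (n : ℕ) : Prop :=
  n ∈ [3, 5, 7, 11, 13, 17, 19, 23, 29, 31, 37, 41, 43] ∨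
    45 ≤ n ∧ Nat.gcd n 13082761331670030 = 1

instance : DecidablePred SmallOddPrime := fun n => by
  unfold SmallOddPrime
  infer_instance

lemma smallOddPrime_of_prime {p : ℕ} (hp : p.Prime) (h2 : p ≠ 2) : SmallOddPrime p := by
  rcases Nat.lt_or_ge p 45 with h | h
  · left
    interval_cases p <;> first | exact absurd rfl h2 | decide | exact absurd hp (by norm_num)
  · refine Or.inr ⟨h, (hp.coprime_iff_not_dvd).2 fun hdvd => ?_⟩
    have hK : (13082761331670030 : ℕ) =
        2 * 3 * 5 * 7 * 11 * 13 * 17 * 19 * 23 * 29 * 31 * 37 * 41 * 43 := by norm_num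
    rw [hK] at hdvd
    simp only [hp.dvd_mul] at hdvd
    rcases hdvd with ((((((((((((h' | h') | h') | h') | h') | h') | h') | h') | h') | h') | h') |
      h') | h') | h' <;> exact absurd (Nat.le_of_dvd (by norm_num) h') (by omega)

lemma relDen_le_relNum_of_smallOddPrime :
    ∀ n < 2000, SmallOddPrime n → relDen n ≤ relNum n := by
  decide +kernel

lemma prod_relNum_le :
    (∏ n ∈ Finset.range 2000, if SmallOddPrime n then relNum n else 1) * 10 ^ 15 ≤
      (∏ n ∈ Finset.range 2000, if SmallOddPrime n then relDen n else 1) * 1042845950000000 := by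
  decide +kernel

lemma avoidFactor_towerExponents (p : ℕ) : avoidFactor towerExponents p =
    1 - (1 - (p : ℝ)⁻¹) * ((p : ℝ)⁻¹ ^ 2 + (p : ℝ)⁻¹ ^ 4 + (p : ℝ)⁻¹ ^ 6 + (p : ℝ)⁻¹ ^ 8 +
      (p : ℝ)⁻¹ ^ 9 + (p : ℝ)⁻¹ ^ 10 + (p : ℝ)⁻¹ ^ 12 + (p : ℝ)⁻¹ ^ 14) := by
  simp [avoidFactor, towerExponents]
  ring

lemma relFactor_eq {n : ℕ} (hn : 2 ≤ n) : relFactor n = (relNum n : ℝ) / relDen n := by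
  have hle : (n - 1) * (n ^ 12 + n ^ 10 + n ^ 8 + n ^ 6 + n ^ 5 + n ^ 4 + n ^ 2 + 1) ≤ n ^ 15 := by
    obtain ⟨m, rfl⟩ : ∃ m, n = m + 2 := ⟨n - 2, by omega⟩
    rw [show m + 2 - 1 = m + 1 by omega]
    zify
    rw [← sub_nonneg]
    ring_nf
    positivity
  have h1 : (1 : ℕ) ≤ n ^ 2 := Nat.one_le_pow _ _ (by omega)
  have hn2 : (2 : ℝ) ≤ n := by exact_mod_cast hn
  have h0 : (n : ℝ) ≠ 0 := by positivity
  have h3 : (n : ℝ) ^ 2 - 1 ≠ 0 := by nlinarith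
  rw [relFactor, avoidFactor_towerExponents, relNum, relDen]
  push_cast [Nat.cast_sub hle, Nat.cast_sub h1, Nat.cast_sub (show 1 ≤ n by omega)]
  have h4 : 1 - ((n : ℝ) ^ 2)⁻¹ ≠ 0 := by
    field_simp
    exact div_ne_zero h3 (by positivity)
  rw [div_eq_div_iff h4 (by positivity)]
  field_simp

lemma relFactor_nonneg {n : ℕ} (hn : 2 ≤ n) : 0 ≤ relFactor n := by
  rw [relFactor_eq hn]
  positivity

lemma relFactor_le_exp {n : ℕ} (hn : 2 ≤ n) : relFactor n ≤ Real.exp (((n : ℝ) ^ 3)⁻¹) := by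
  refine le_trans ?_ (Real.add_one_le_exp _)
  have hn2 : (2 : ℝ) ≤ n := by exact_mod_cast hn
  have hx0 : 0 < (n : ℝ)⁻¹ := by positivity
  have hx : (n : ℝ)⁻¹ ≤ 2⁻¹ := by gcongr
  rw [relFactor, avoidFactor_towerExponents, ← inv_pow, ← inv_pow]
  set x := (n : ℝ)⁻¹
  have hx2 : x ^ 2 ≤ 1 / 4 := by nlinarith
  rw [div_le_iff₀ (by linarith)]
  have h1 : 0 ≤ (1 - x) * (x ^ 6 + x ^ 8 + x ^ 9 + x ^ 10 + x ^ 12 + x ^ 14) :=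
    mul_nonneg (by linarith) (by positivity)
  have h2 : 0 ≤ x ^ 4 * (1 - 2 * x) := mul_nonneg (by positivity) (by linarith)
  nlinarith

lemma sum_Ico_inv_cube_le (a b : ℕ) (ha : 2 ≤ a) (hab : a ≤ b) :
    ∑ n ∈ Finset.Ico a b, ((n : ℝ) ^ 3)⁻¹ ≤
      (2 * (a : ℝ) * (a - 1))⁻¹ - (2 * (b : ℝ) * (b - 1))⁻¹ := by
  induction b, hab using Nat.le_induction with
  | base => simp
  | succ b hb ih =>
    rw [Finset.sum_Ico_succ_top hb]
    have hb2 : (2 : ℝ) ≤ b := by exact_mod_cast ha.trans hb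
    have hb1 : 0 < (b : ℝ) - 1 := by linarith
    have : ((b : ℝ) ^ 3)⁻¹ ≤ (2 * (b : ℝ) * (b - 1))⁻¹ - (2 * ((b : ℝ) + 1) * b)⁻¹ := by
      have : (2 * (b : ℝ) * (b - 1))⁻¹ - (2 * ((b : ℝ) + 1) * b)⁻¹ =
          ((b : ℝ) * (b - 1) * (b + 1))⁻¹ := by
        field_simp
        ring
      rw [this]
      gcongr
      nlinarith
    push_cast
    rw [add_sub_cancel_right]
    linarith

lemma prod_range_relFactor_le :
    ∏ n ∈ Finset.range 2000, (if n.Prime ∧ n ≠ 2 then relFactor n else 1) ≤ 1.04284595 := by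
  have hpos : ∀ n, SmallOddPrime n → 2 ≤ n := by
    intro n hn
    rcases hn with h | h
    · simp only [List.mem_cons, List.not_mem_nil, or_false] at h
      omega
    · omega
  have hden : ∀ n, SmallOddPrime n → 0 < relDen n := by
    intro n hn
    have h2 := hpos n hn
    exact Nat.mul_pos (pow_pos (by omega) _) (Nat.sub_pos_of_lt (Nat.one_lt_pow (by norm_num) h2))
  calc _ ≤ ∏ n ∈ Finset.range 2000, (((if SmallOddPrime n then relNum n else 1 : ℕ) : ℝ) /
        ((if SmallOddPrime n then relDen n else 1 : ℕ) : ℝ)) := by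
        refine Finset.prod_le_prod (fun n _ => ?_) fun n hn => ?_
        · split_ifs with h
          · exact relFactor_nonneg h.1.two_le
          · exact zero_le_one
        · by_cases h : n.Prime ∧ n ≠ 2
          · simp [h, smallOddPrime_of_prime h.1 h.2, relFactor_eq h.1.two_le]
          · rw [if_neg h]
            by_cases hs : SmallOddPrime n
            · have := relDen_le_relNum_of_smallOddPrime n (Finset.mem_range.1 hn) hs
              have h0 : (0 : ℝ) < relDen n := by exact_mod_cast hden n hs
              simp only [hs, if_true]
              rw [one_le_div h0]
              exact_mod_cast this
            · simp [hs]
    _ ≤ _ := by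
        have h0 : 0 < ∏ n ∈ Finset.range 2000, if SmallOddPrime n then relDen n else 1 := by
          refine Finset.prod_pos fun n _ => ?_
          split_ifs with h
          · exact hden n h
          · exact one_pos
        have h := prod_relNum_le
        rw [Finset.prod_div_distrib, ← Nat.cast_prod, ← Nat.cast_prod]
        generalize (∏ n ∈ Finset.range 2000, if SmallOddPrime n then relNum n else 1) = a at *
        generalize (∏ n ∈ Finset.range 2000, if SmallOddPrime n then relDen n else 1) = b at *
        rw [div_le_iff₀ (by exact_mod_cast h0)]
        have h' : (a : ℝ) * 10 ^ 15 ≤ b * 1042845950000000 := by exact_mod_cast h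
        linarith

lemma prod_primesBelow_relFactor_le {X : ℕ} (hX : 2000 ≤ X) :
    ∏ p ∈ X.primesBelow.erase 2, relFactor p ≤ 1.04284595 * Real.exp (1 / 7990000) := by
  have hset : X.primesBelow.erase 2 = (Finset.range X).filter fun n => n.Prime ∧ n ≠ 2 := by
    ext n
    simp [Nat.mem_primesBelow]
    tauto
  rw [hset, Finset.prod_filter, ← Finset.prod_range_mul_prod_Ico _ hX]
  refine mul_le_mul prod_range_relFactor_le ?_ ?_ (by norm_num)
  · calc _ ≤ ∏ n ∈ Finset.Ico 2000 X, Real.exp (((n : ℝ) ^ 3)⁻¹) := by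
          refine Finset.prod_le_prod (fun n _ => ?_) fun n _ => ?_
          · split_ifs with h
            · exact relFactor_nonneg h.1.two_le
            · exact zero_le_one
          · split_ifs with h
            · exact relFactor_le_exp h.1.two_le
            · exact Real.one_le_exp (by positivity)
      _ ≤ _ := by
          rw [← Real.exp_sum]
          gcongr
          refine (sum_Ico_inv_cube_le 2000 X (by norm_num) hX).trans ?_
          have hX' : (2000 : ℝ) ≤ X := by exact_mod_cast hX
          have : 0 ≤ (2 * (X : ℝ) * (X - 1))⁻¹ :=
            inv_nonneg.2 (mul_nonneg (by linarith) (by linarith))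
          norm_num
          norm_num at this
          linarith
  · refine Finset.prod_nonneg fun n _ => ?_
    split_ifs with h
    · exact relFactor_nonneg h.1.two_le
    · exact zero_le_one

lemma tendsto_prod_primesBelow_one_sub_inv_sq :
    Tendsto (fun X : ℕ => ∏ p ∈ X.primesBelow, (1 - ((p : ℝ) ^ 2)⁻¹)) atTop
      (𝓝 (6 / Real.pi ^ 2)) := by
  let f : ℕ →*₀ ℝ :=
    { toFun := fun n => ((n : ℝ) ^ 2)⁻¹
      map_zero' := by simp
      map_one' := by simp
      map_mul' := fun a b => by
        push_cast
        rw [mul_pow, mul_inv] }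
  have hsum : HasSum f (Real.pi ^ 2 / 6) := by
    simpa [f] using hasSum_zeta_two
  have h := EulerProduct.eulerProduct_completely_multiplicative (f := f) hsum.summable.norm
  rw [hsum.tsum_eq] at h
  have h' := h.inv₀ (by positivity)
  rw [inv_div] at h'
  refine h'.congr fun X => ?_
  rw [Finset.prod_inv_distrib, inv_inv]
  rfl

lemma one_sub_le_four_div_pi_sq {d : ℝ} (hd : Tendsto (towerRatio 2) atTop (𝓝 d)) :
    1 - d ≤ 1 / 2 * (8 / Real.pi ^ 2 * (1.04284595 * Real.exp (1 / 7990000))) := by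
  have h1 : Tendsto (fun X : ℕ => ∏ p ∈ X.primesBelow.erase 2, (1 - ((p : ℝ) ^ 2)⁻¹)) atTop
      (𝓝 (8 / Real.pi ^ 2)) := by
    refine ((tendsto_prod_primesBelow_one_sub_inv_sq.mul_const (4 / 3)).congr' ?_).trans_eq
      (by ring_nf)
    filter_upwards [eventually_ge_atTop 3] with X hX
    have h2 : 2 ∈ X.primesBelow := Nat.mem_primesBelow.2 ⟨by omega, Nat.prime_two⟩
    rw [← Finset.mul_prod_erase _ _ h2]
    norm_num
    ring
  refine ge_of_tendsto ((h1.mul_const _).const_mul _) ?_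
  filter_upwards [eventually_ge_atTop 2000] with X hX
  have hT : ∀ p ∈ X.primesBelow.erase 2, p.Prime ∧ p ≠ 2 := fun p hp =>
    ⟨Nat.prime_of_mem_primesBelow (Finset.mem_of_mem_erase hp), Finset.ne_of_mem_erase hp⟩
  have hpos : ∀ p ∈ X.primesBelow.erase 2, 0 < 1 - ((p : ℝ) ^ 2)⁻¹ := by
    intro p hp
    have : (1 : ℝ) < p := by exact_mod_cast (hT p hp).1.one_lt
    rw [sub_pos]
    exact inv_lt_one_of_one_lt₀ (one_lt_pow₀ this two_ne_zero)
  refine (one_sub_le_of_tendsto_towerRatio hd hT).trans ?_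
  have hsplit : ∏ p ∈ X.primesBelow.erase 2, avoidFactor towerExponents p =
      (∏ p ∈ X.primesBelow.erase 2, (1 - ((p : ℝ) ^ 2)⁻¹)) *
        ∏ p ∈ X.primesBelow.erase 2, relFactor p := by
    rw [← Finset.prod_mul_distrib]
    exact Finset.prod_congr rfl fun p hp => (mul_div_cancel₀ _ (hpos p hp).ne').symm
  rw [hsplit]
  gcongr
  · exact Finset.prod_nonneg fun p hp => (hpos p hp).le
  · exact prod_primesBelow_relFactor_le hX

lemma one_div_sqrt_three_lt {d : ℝ} (hd : Tendsto (towerRatio 2) atTop (𝓝 d)) :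
    1 / Real.sqrt 3 < d := by
  have h := one_sub_le_four_div_pi_sq hd
  have hexp : Real.exp (1 / 7990000) ≤ 7990000 / 7989999 := by
    have := Real.add_one_le_exp (-(1 / 7990000) : ℝ)
    rw [Real.exp_neg] at this
    have h2 := inv_anti₀ (by norm_num) this
    rw [inv_inv] at h2
    norm_num at h2 ⊢
    exact h2
  have hpi : 8 / Real.pi ^ 2 ≤ 8 / 3.1415926535 ^ 2 := by
    have := Real.pi_gt_d20
    gcongr
    linarith
  have hsqrt : 1 / Real.sqrt 3 < 0.57735027 := by
    rw [div_lt_iff₀ (by positivity), ← div_lt_iff₀' (by norm_num), Real.lt_sqrt (by norm_num)]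
    norm_num
  have hbound : 8 / Real.pi ^ 2 * (1.04284595 * Real.exp (1 / 7990000)) ≤
      8 / 3.1415926535 ^ 2 * (1.04284595 * (7990000 / 7989999)) := by
    gcongr
  have hnum : (1 : ℝ) / 2 * (8 / 3.1415926535 ^ 2 * (1.04284595 * (7990000 / 7989999))) <
      1 - 0.57735027 := by norm_num
  linarith

lemma antitone_harmonic_sub_log_add_half :
    Antitone fun n : ℕ => (harmonic n : ℝ) - Real.log (n + 1 / 2) := by
  refine antitone_nat_of_succ_le fun n => ?_
  have h := Real.le_log_one_add_of_nonneg (x := 1 / ((n : ℝ) + 1 / 2)) (by positivity)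
  have e1 : 1 + 1 / ((n : ℝ) + 1 / 2) = (n + 1 + 1 / 2) / (n + 1 / 2) := by
    field_simp
    ring
  have e2 : 2 * (1 / ((n : ℝ) + 1 / 2)) / (1 / ((n : ℝ) + 1 / 2) + 2) = ((n : ℝ) + 1)⁻¹ := by
    field_simp
    ring
  rw [e1, e2, Real.log_div (by positivity) (by positivity)] at h
  rw [harmonic_succ]
  push_cast
  linarith

lemma eulerMascheroniConstant_le_harmonic_sub_log_add_half (n : ℕ) :
    Real.eulerMascheroniConstant ≤ harmonic n - Real.log (n + 1 / 2) := by
  refine antitone_harmonic_sub_log_add_half.le_of_tendsto ?_ n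
  have h := (Real.tendsto_log_comp_add_sub_log (1 / 2)).comp (tendsto_natCast_atTop_atTop (R := ℝ))
  refine ((Real.tendsto_harmonic_sub_log.sub h).congr fun n => ?_).trans_eq (by simp)
  simp only [Function.comp]
  ring

lemma eulerMascheroniConstant_lt_one_div_sqrt_three :
    Real.eulerMascheroniConstant < 1 / Real.sqrt 3 := by
  have h := eulerMascheroniConstant_le_harmonic_sub_log_add_half 32
  have hlog : Real.log (((32 : ℕ) : ℝ) + 1 / 2) = 5 * Real.log 2 + Real.log (1 + 1 / 64) := by
    rw [show (((32 : ℕ) : ℝ) + 1 / 2) = 2 ^ 5 * (1 + 1 / 64) by norm_num,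
      Real.log_mul (by norm_num) (by norm_num), Real.log_pow]
    norm_num
  have h64 := Real.le_log_one_add_of_nonneg (x := 1 / 64) (by norm_num)
  have hharm : ((harmonic 32 : ℚ) : ℝ) < 4.058496 := by
    norm_num [harmonic, Finset.sum_range_succ]
  have h2 := Real.log_two_gt_d9
  have h3 : 0.57735 < 1 / Real.sqrt 3 := by
    rw [lt_div_iff₀ (by positivity), ← lt_div_iff₀' (by norm_num), Real.sqrt_lt' (by norm_num)]
    norm_num
  norm_num at *
  linarith

theorem tower_density_two_vs_gamma_and_sqrt3 (d : ℝ)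
    (hd : Tendsto (towerRatio 2) atTop (𝓝 d)) :
    Real.eulerMascheroniConstant < 1 / Real.sqrt 3 ∧ 1 / Real.sqrt 3 < d ∧
    d ≠ Real.eulerMascheroniConstant ∧ d ≠ 1 / Real.sqrt 3 := by
  have h1 := eulerMascheroniConstant_lt_one_div_sqrt_three
  have h2 := one_div_sqrt_three_lt hd
  exact ⟨h1, h2, (h1.trans h2).ne', h2.ne'⟩
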